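/- Let k be an algebraically closed field of characteristic zero and let 𝔤 be a finite-dimensional semisimple Lie algebra over k. Let U(𝔤) be the universal enveloping algebra of 𝔤 with canonical embedding ι : 𝔤 → U(𝔤). Then for every n ≥ 1, every family of scalars a₁, …, aₙ ∈ k, and every family of nonzero elements ℓ₁, …, ℓₙ ∈ 𝔤, the ordered product (a₁·1 + ι(ℓ₁))(a₂·1 + ι(ℓ₂))⋯(aₙ·1 + ι(ℓₙ)) does not lie in the center of U(𝔤). In other words, no central element of U(𝔤) is a nontrivial product of elements of (k + 𝔤) \ k. -/

import Mathlib

/-- The derivative of `∏ i ∈ l, p i`, where `q i` is the derivative of `p i`. -/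
def List.productRule {ι R : Type*} [CommSemiring R] (p q : ι → R) : List ι → R
  | [] => 0
  | i :: l => q i * (l.map p).prod + p i * List.productRule p q l

lemma List.map_productRule {ι R S : Type*} [CommSemiring R] [CommSemiring S] (φ : R →+* S)
    (p q : ι → R) (l : List ι) :
    φ (l.productRule p q) = l.productRule (fun i => φ (p i)) (fun i => φ (q i)) := by
  induction l with
  | nil => simp [productRule]
  | cons i l ih => simp [productRule, ih, map_list_prod, Function.comp_def]

section LeibnizRule

variable {ι B R : Type*} [Ring B] [CommRing R] (δ : B →+ B)

lemma iterate_succ_mul_of_sq_eq_zero (hδ : ∀ S T, δ (S * T) = δ S * T + S * δ T)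
    {S : B} (hS : δ (δ S) = 0) (T : B) (n : ℕ) :
    δ^[n + 1] (S * T) = S * δ^[n + 1] T + (n + 1) • (δ S * δ^[n] T) := by
  induction n with
  | zero => simp [hδ, add_comm]
  | succ n ih =>
    rw [Function.iterate_succ_apply', ih, map_add, map_nsmul, hδ, hδ, hS,
      ← Function.iterate_succ_apply' δ, ← Function.iterate_succ_apply' δ, zero_mul, zero_add,
      succ_nsmul _ (n + 1)]
    abel

lemma iterate_length_prod (hδ : ∀ S T, δ (S * T) = δ S * T + S * δ T) (ρ : R →+* B)
    (hρ : ∀ r, δ (ρ r) = 0) (T : ι → B) (p : ι → R) (hT : ∀ i, δ (T i) = ρ (p i))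
    (l : List ι) :
    δ^[l.length] (l.map T).prod = l.length.factorial • ρ (l.map p).prod := by
  induction l with
  | nil => simp
  | cons i l ih =>
    have h : δ^[l.length + 1] (l.map T).prod = 0 := by
      rw [Function.iterate_succ_apply', ih, map_nsmul, hρ, smul_zero]
    rw [List.length_cons, List.map_cons, List.prod_cons,
      iterate_succ_mul_of_sq_eq_zero δ hδ (by rw [hT, hρ]), h, ih, hT, List.map_cons,
      List.prod_cons, map_mul, mul_zero, zero_add, mul_smul_comm, smul_smul, Nat.factorial_succ]

lemma iterate_length_commutator_prod (hδ : ∀ S T, δ (S * T) = δ S * T + S * δ T) (ρ : R →+* B)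
    (hρ : ∀ r, δ (ρ r) = 0) (T : ι → B) (p q : ι → R) (hT : ∀ i, δ (T i) = ρ (p i)) (Y : B)
    (hY : ∀ i, δ (Y * T i - T i * Y) = ρ (q i)) (l : List ι) :
    δ^[l.length] (Y * (l.map T).prod - (l.map T).prod * Y) =
      l.length.factorial • ρ (l.productRule p q) := by
  induction l with
  | nil => simp [List.productRule]
  | cons i l ih =>
    have h : δ^[l.length + 1] (l.map T).prod = 0 := by
      rw [Function.iterate_succ_apply', iterate_length_prod δ hδ ρ hρ T p hT, map_nsmul, hρ,
        smul_zero]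
    have h' : δ^[l.length + 1] (Y * (l.map T).prod - (l.map T).prod * Y) = 0 := by
      rw [Function.iterate_succ_apply', ih, map_nsmul, hρ, smul_zero]
    have e : Y * (T i * (l.map T).prod) - T i * (l.map T).prod * Y =
        (Y * T i - T i * Y) * (l.map T).prod +
          T i * (Y * (l.map T).prod - (l.map T).prod * Y) := by noncomm_ring
    rw [List.length_cons, List.map_cons, List.prod_cons, e, iterate_map_add,
      iterate_succ_mul_of_sq_eq_zero δ hδ (by rw [hY, hρ]),
      iterate_succ_mul_of_sq_eq_zero δ hδ (by rw [hT, hρ]), h, h', ih,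
      iterate_length_prod δ hδ ρ hρ T p hT, hT, hY]
    simp only [List.productRule, mul_zero, zero_add, mul_smul_comm, smul_smul, map_add, map_mul,
      smul_add, Nat.factorial_succ]

end LeibnizRule

section Invariance

attribute [local instance] LieRing.ofAssociativeRing

/-- The bracket with multiplication by `f`, as an endomorphism of the algebra of operators. -/
def commutatorWithMul (k : Type*) {A : Type*} [Field k] [CommRing A] [Algebra k A] (f : A) :
    Module.End k A →+ Module.End k A where
  toFun T := T * Algebra.lmul k A f - Algebra.lmul k A f * T
  map_zero' := by simp
  map_add' S T := by noncomm_ring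

variable {k A L : Type*} [Field k] [CharZero k] [CommRing A] [Algebra k A]
  [LieRing L] [LieAlgebra k L]

lemma productRule_eq_zero_of_prod_mem_center (ρ : L →ₗ⁅k⁆ Derivation k A A) {ι : Type*}
    (a : ι → k) (x : ι → L) (l : List ι)
    (hl : (l.map fun i => algebraMap k (UniversalEnvelopingAlgebra k L) (a i)
          + UniversalEnvelopingAlgebra.ι k (x i)).prod
      ∈ Subalgebra.center k (UniversalEnvelopingAlgebra k L)) (y : L) (f : A) :
    l.productRule (fun i => ρ (x i) f) (fun i => ρ ⁅y, x i⁆ f) = 0 := by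
  let Φ : UniversalEnvelopingAlgebra k L →ₐ[k] Module.End k A :=
    UniversalEnvelopingAlgebra.lift k ((LieModule.toEnd k (Derivation k A A) A).comp ρ)
  have hΦ (z : L) : Φ (UniversalEnvelopingAlgebra.ι k z) = (ρ z : A →ₗ[k] A) := by
    simp only [Φ, UniversalEnvelopingAlgebra.lift_ι_apply]
    rfl
  have hcomm := congrArg Φ (Subalgebra.mem_center_iff.mp hl (UniversalEnvelopingAlgebra.ι k y))
  have key := iterate_length_commutator_prod (commutatorWithMul k f)
    (fun S T => by simp only [commutatorWithMul, AddMonoidHom.coe_mk, ZeroHom.coe_mk]; noncomm_ring)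
    (Algebra.lmul k A : A →+* Module.End k A)
    (fun r => by ext; simp [commutatorWithMul, mul_left_comm])
    (fun i => Φ (algebraMap k _ (a i) + UniversalEnvelopingAlgebra.ι k (x i)))
    (fun i => ρ (x i) f) (fun i => ρ ⁅y, x i⁆ f)
    (fun i => by
      ext g
      simp [commutatorWithMul, hΦ, -UniversalEnvelopingAlgebra.ι_apply, Algebra.smul_def]
      ring)
    (Φ (UniversalEnvelopingAlgebra.ι k y))
    (fun i => by
      ext g
      simp [commutatorWithMul, hΦ, -UniversalEnvelopingAlgebra.ι_apply,
        Derivation.commutator_apply]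
      ring) l
  rw [map_mul, map_mul, map_list_prod, List.map_map, Function.comp_def] at hcomm
  rw [hcomm, sub_self, iterate_map_zero] at key
  have h1 := LinearMap.congr_fun key 1
  rw [← Nat.cast_smul_eq_nsmul k] at h1
  simpa [Nat.factorial_ne_zero] using h1.symm

end Invariance

section MatrixCoordinates

variable {k ι L : Type*} [Field k] [Fintype ι] [DecidableEq ι] [LieRing L] [LieAlgebra k L]

attribute [local instance] LieRing.ofAssociativeRing

open MvPolynomial in
/-- The action of a Lie algebra of matrices on the polynomial functions on the space of matrices
by left-invariant vector fields. -/
noncomputable def matrixDerivation (M : L →ₗ⁅k⁆ Matrix ι ι k) :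
    L →ₗ⁅k⁆ Derivation k (MvPolynomial (ι × ι) k) (MvPolynomial (ι × ι) k) where
  toFun x := mkDerivation k fun ij => ∑ m, X (ij.1, m) * C (M x m ij.2)
  map_add' x y := by
    ext1 ij
    simp [mul_add, Finset.sum_add_distrib]
  map_smul' c x := by
    ext1 ij
    simp [Finset.smul_sum, smul_eq_C_mul, mul_left_comm]
  map_lie' {x y} := by
    ext1 ij
    have h (P Q : Matrix ι ι k) : ∑ m, mkDerivation k
          (fun ij : ι × ι => ∑ m, X (ij.1, m) * C (P m ij.2)) (X (ij.1, m)) * C (Q m ij.2) =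
        ∑ m, X (ij.1, m) * C ((P * Q) m ij.2) := by
      simp only [mkDerivation_X, Matrix.mul_apply, map_sum, Finset.mul_sum, Finset.sum_mul, map_mul]
      rw [Finset.sum_comm]
      simp only [mul_assoc]
    have h' (P Q : Matrix ι ι k) : mkDerivation k
          (fun ij : ι × ι => ∑ m, X (ij.1, m) * C (P m ij.2))
          (∑ m, X (ij.1, m) * C (Q m ij.2)) = ∑ m, X (ij.1, m) * C ((P * Q) m ij.2) := by
      rw [← h, map_sum]
      refine Finset.sum_congr rfl fun m _ => ?_
      rw [mul_comm, ← smul_eq_C_mul, Derivation.map_smul, smul_eq_C_mul, mul_comm]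
    rw [Derivation.commutator_apply, mkDerivation_X, mkDerivation_X, mkDerivation_X, h', h',
      ← Finset.sum_sub_distrib, LieHom.map_lie, LieRing.of_associative_ring_bracket]
    simp only [Matrix.sub_apply, map_sub, mul_sub]

lemma exists_eval_matrixDerivation_eq (M : L →ₗ⁅k⁆ Matrix ι ι k) (hM : Function.Injective M)
    (φ : Module.Dual k L) :
    ∃ f : MvPolynomial (ι × ι) k, ∀ x,
      MvPolynomial.eval (fun ij : ι × ι => if ij.1 = ij.2 then 1 else 0)
        (matrixDerivation M x f) = φ x := by
  obtain ⟨g, hg⟩ := (M : L →ₗ[k] Matrix ι ι k).exists_leftInverse_of_injective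
    (LinearMap.ker_eq_bot.mpr hM)
  refine ⟨∑ i, ∑ j, MvPolynomial.C (φ (g (Matrix.single i j 1))) * MvPolynomial.X (i, j),
    fun x => ?_⟩
  have h : φ (g (M x)) = φ x := congrArg φ (LinearMap.congr_fun hg x)
  rw [← h]
  conv_rhs => rw [Matrix.matrix_eq_sum_single (M x)]
  have hs (i j : ι) : Matrix.single i j (M x i j) = M x i j • Matrix.single i j (1 : k) := by simp
  simp only [hs, map_sum, map_smul, smul_eq_mul]
  simp [matrixDerivation, mul_comm]

end MatrixCoordinates

section Residue

open Polynomial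

variable {k ι : Type*} [Field k]

/-- The logarithmic derivative of `∏ i ∈ l, p i` has a pole at the origin as soon as one
factor vanishes there, all such factors being multiples of `X` with proportional derivatives. -/
lemma exists_X_mul_productRule_eq (p q : ι → k[X]) (q₀ : k[X])
    (h : ∀ i, (p i).eval 0 ≠ 0 ∨ ∃ c : k, c ≠ 0 ∧ p i = C c * X ∧ q i = C c * q₀)
    (l : List ι) :
    ∃ (m : ℕ) (s r : k[X]), (l.map p).prod = X ^ m * s ∧ X * l.productRule p q = X ^ m * r ∧
      s.eval 0 ≠ 0 ∧ r.eval 0 = m * q₀.eval 0 * s.eval 0 ∧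
      ((∃ i ∈ l, (p i).eval 0 = 0) → m ≠ 0) := by
  induction l with
  | nil => exact ⟨0, 1, 0, by simp [List.productRule]⟩
  | cons i l ih =>
    obtain ⟨m, s, r, hs, hr, hs0, hr0, hm⟩ := ih
    rcases h i with hi | ⟨c, hc, hp, hq⟩
    · refine ⟨m, p i * s, X * (q i * s) + p i * r, ?_, ?_, by simp [hi, hs0], ?_, ?_⟩
      · rw [List.map_cons, List.prod_cons, hs]; ring
      · rw [List.productRule, hs]; linear_combination p i * hr
      · simp only [eval_add, eval_mul, eval_X, hr0]; ring
      · rintro ⟨j, hj, hj0⟩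
        rcases List.mem_cons.mp hj with rfl | hj
        · exact absurd hj0 hi
        · exact hm ⟨j, hj, hj0⟩
    · refine ⟨m + 1, C c * s, C c * (q₀ * s + r), ?_, ?_, by simp [hc, hs0], ?_, by simp⟩
      · rw [List.map_cons, List.prod_cons, hs, hp]; ring
      · rw [List.productRule, hs, hp, hq]; linear_combination C c * X * hr
      · simp only [eval_add, eval_mul, eval_C, hr0]; push_cast; ring

lemma productRule_ne_zero [CharZero k] (p q : ι → k[X]) (q₀ : k[X]) (hq₀ : q₀.eval 0 ≠ 0)
    (h : ∀ i, (p i).eval 0 ≠ 0 ∨ ∃ c : k, c ≠ 0 ∧ p i = C c * X ∧ q i = C c * q₀)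
    (l : List ι) (hl : ∃ i ∈ l, (p i).eval 0 = 0) : l.productRule p q ≠ 0 := by
  intro h0
  obtain ⟨m, s, r, -, hr, hs0, hr0, hm⟩ := exists_X_mul_productRule_eq p q q₀ h l
  have hr' : r = 0 := by simpa [h0] using hr
  have := hm hl
  simp_all

end Residue

section Dual

open Polynomial

variable {k L ι : Type*} [Field k] [CharZero k] [LieRing L] [LieAlgebra k L]

lemma exists_dual_productRule_ne_zero [Finite ι] (x : ι → L) (hx : ∀ i, x i ≠ 0) (y : L) (i₀ : ι)
    (hy : ⁅y, x i₀⁆ ∉ Submodule.span k {x i₀}) (l : List ι) (hi₀ : i₀ ∈ l) :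
    ∃ φ : Module.Dual k L, l.productRule (fun i => φ (x i)) (fun i => φ ⁅y, x i⁆) ≠ 0 := by
  classical
  set N := Submodule.span k {x i₀}
  let v : Option {i // x i ∉ N} → L := fun o => o.elim ⁅y, x i₀⁆ fun i => x i
  have hv (o) : N.mkQ (v o) ≠ 0 := by
    rw [Submodule.mkQ_apply, ne_eq, Submodule.Quotient.mk_eq_zero]
    rcases o with _ | i
    exacts [hy, i.2]
  obtain ⟨ψ, hψ⟩ := Module.exists_dual_forall_apply_ne_zero (K := k) _ hv
  obtain ⟨μ, hμ⟩ := Module.Projective.exists_dual_eq_one k (hx i₀)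
  let lam : Module.Dual k L := ψ ∘ₗ N.mkQ
  let P (z : L) : k[X] := C (lam z) + C (μ z) * X
  have hP : l.productRule (fun i => P (x i)) (fun i => P ⁅y, x i⁆) ≠ 0 := by
    have hlam₀ : lam (x i₀) = 0 := by
      simpa [lam] using congrArg ψ ((Submodule.Quotient.mk_eq_zero N).mpr
        (Submodule.mem_span_singleton_self (x i₀)))
    refine productRule_ne_zero _ _ (P ⁅y, x i₀⁆) (by simpa [P] using show lam ⁅y, x i₀⁆ ≠ 0 from hψ none) (fun i => ?_) l
      ⟨i₀, hi₀, by simp [P, hlam₀]⟩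
    by_cases hi : x i ∈ N
    · obtain ⟨c, hc⟩ := Submodule.mem_span_singleton.mp hi
      refine .inr ⟨c, fun h => hx i (by rw [← hc, h, zero_smul]), ?_, ?_⟩
      · simp [P, ← hc, hlam₀, hμ]
      · simp [P, ← hc, mul_add, mul_assoc]
    · exact .inl (by simpa [P] using show lam (x i) ≠ 0 from hψ (some ⟨i, hi⟩))
  contrapose! hP
  refine Polynomial.funext fun t => ?_
  have := hP (lam + t • μ)
  rw [← coe_evalRingHom, List.map_productRule]
  simpa [P, mul_comm t] using this

end Dual

lemma exists_lie_notMem_span {k L : Type*} [Field k] [LieRing L] [LieAlgebra k L]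
    [LieAlgebra.HasTrivialRadical k L] {x : L} (hx : x ≠ 0) :
    ∃ y : L, ⁅y, x⁆ ∉ Submodule.span k {x} := by
  by_contra! h
  let I : LieIdeal k L :=
    { Submodule.span k {x} with
      lie_mem := by
        intro y z hz
        obtain ⟨c, rfl⟩ := Submodule.mem_span_singleton.mp hz
        rw [lie_smul]
        exact Submodule.smul_mem _ c (h y) }
  have hI : IsLieAbelian I := ⟨by
    rintro ⟨u, hu⟩ ⟨v, hv⟩
    obtain ⟨c, rfl⟩ := Submodule.mem_span_singleton.mp hu
    obtain ⟨d, rfl⟩ := Submodule.mem_span_singleton.mp hv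
    ext
    simp⟩
  have hbot := (LieAlgebra.hasTrivialRadical_iff_no_abelian_ideals k L).mp inferInstance I hI
  have hxI : x ∈ I := Submodule.mem_span_singleton_self x
  rw [hbot, LieSubmodule.mem_bot] at hxI
  exact hx hxI

section AdjointMatrix

attribute [local instance] LieRing.ofAssociativeRing

lemma exists_injective_lieHom_matrix (k L : Type*) [Field k] [LieRing L] [LieAlgebra k L]
    [FiniteDimensional k L] [LieAlgebra.HasTrivialRadical k L] :
    ∃ M : L →ₗ⁅k⁆ Matrix (Fin (Module.finrank k L)) (Fin (Module.finrank k L)) k,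
      Function.Injective M := by
  let e := LinearMap.toMatrixAlgEquiv (Module.finBasis k L)
  refine ⟨(e : Module.End k L →ₐ[k] _).toLieHom.comp (LieAlgebra.ad k L), ?_⟩
  exact e.injective.comp ((LieHom.ker_eq_bot _).mp (LieAlgebra.ad_ker_eq_bot_of_hasTrivialRadical k L))

end AdjointMatrix


/-- No central element of `U(𝔤)` is a nontrivial product of elements of
`(k + 𝔤) \ k`: for a finite-dimensional semisimple Lie algebra `𝔤` over an
algebraically closed field `k` of characteristic zero, any ordered product
`(a₁·1 + ι ℓ₁) ⋯ (aₙ·1 + ι ℓₙ)` with `n ≥ 1`, `aᵢ ∈ k` and `0 ≠ ℓᵢ ∈ 𝔤` does not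
lie in the center of the universal enveloping algebra `U(𝔤)`. -/
theorem prod_not_mem_center_universalEnvelopingAlgebra
    (k : Type*) [Field k] [IsAlgClosed k] [CharZero k]
    (L : Type*) [LieRing L] [LieAlgebra k L] [FiniteDimensional k L]
    [LieAlgebra.IsSemisimple k L]
    (n : ℕ) (hn : 1 ≤ n) (a : Fin n → k) (x : Fin n → L) (hx : ∀ i, x i ≠ 0) :
    (List.ofFn fun i : Fin n =>
        algebraMap k (UniversalEnvelopingAlgebra k L) (a i)
          + UniversalEnvelopingAlgebra.ι k (x i)).prod
      ∉ Subalgebra.center k (UniversalEnvelopingAlgebra k L) := by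
  intro hmem
  rw [List.ofFn_eq_map] at hmem
  let i₀ : Fin n := ⟨0, hn⟩
  obtain ⟨y, hy⟩ := exists_lie_notMem_span (k := k) (hx i₀)
  obtain ⟨φ, hφ⟩ := exists_dual_productRule_ne_zero x hx y i₀ hy _ (List.mem_finRange i₀)
  obtain ⟨M, hM⟩ := exists_injective_lieHom_matrix k L
  obtain ⟨f, hf⟩ := exists_eval_matrixDerivation_eq M hM φ
  apply hφ
  have h := productRule_eq_zero_of_prod_mem_center (matrixDerivation M) a x _ hmem y f
  simpa only [List.map_productRule, hf, map_zero] using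
    congrArg (MvPolynomial.eval fun ij : _ × _ => if ij.1 = ij.2 then 1 else 0) h
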